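/- arXiv:1801.05589 — 8 statements merged into one kernel-verified Lean document; each statement's English description precedes it below -/
import Mathlib

section
/- Let γ ∈ (0, 2/L) and let T be a proximal-gradient map for (f, g, γ). Set ν := 2/(1 + 2·min{1, 1/(γL)}). Then for all x, y ∈ ℝⁿ: ‖T x − T y‖² + ((1 − ν)/ν)·‖(x − T x) − (y − T y)‖² ≤ ‖x − y‖². -/
open scoped RealInnerProductSpace

section ProximalGradient

variable {E : Type*} [NormedAddCommGroup E] [InnerProductSpace ℝ E]

/-- The variational inequality characterising the proximal point `p` of `u`. -/
theorem inner_sub_le_of_isProx {g : E → ℝ} (hg : ConvexOn ℝ Set.univ g) {γ : ℝ} (hγ : 0 < γ)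
    {p u : E}
    (hp : ∀ w, g p + (1 / (2 * γ)) * ‖p - u‖ ^ 2 ≤ g w + (1 / (2 * γ)) * ‖w - u‖ ^ 2) (w : E) :
    γ * (g p - g w) ≤ ⟪p - u, w - p⟫ := by
  have key : ∀ t ∈ Set.Ioo (0 : ℝ) 1,
      γ * (g p - g w) - ⟪p - u, w - p⟫ ≤ t * (‖w - p‖ ^ 2 / 2) := by
    rintro t ⟨ht0, ht1⟩
    have hconv := hg.2 (Set.mem_univ p) (Set.mem_univ w) (sub_nonneg.2 ht1.le) ht0.le
      (sub_add_cancel 1 t)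
    simp only [smul_eq_mul] at hconv
    have hmin := hp ((1 - t) • p + t • w)
    have hnorm : ‖(1 - t) • p + t • w - u‖ ^ 2
        = ‖p - u‖ ^ 2 + 2 * (t * ⟪p - u, w - p⟫) + t ^ 2 * ‖w - p‖ ^ 2 := by
      rw [show (1 - t) • p + t • w - u = (p - u) + t • (w - p) by module, norm_add_sq_real,
        inner_smul_right, norm_smul, mul_pow, Real.norm_eq_abs, sq_abs]
    rw [hnorm] at hmin
    have hscaled : t * (g p - g w)
        ≤ (1 / (2 * γ)) * (2 * (t * ⟪p - u, w - p⟫) + t ^ 2 * ‖w - p‖ ^ 2) := by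
      linarith
    rw [one_div_mul_eq_div, le_div_iff₀ (by positivity)] at hscaled
    refine le_of_mul_le_mul_left ?_ ht0
    linarith
  by_contra! hlt
  set a := γ * (g p - g w) - ⟪p - u, w - p⟫ with ha
  have ha0 : 0 < a := by linarith
  have hb : 0 ≤ ‖w - p‖ ^ 2 / 2 := by positivity
  set b := ‖w - p‖ ^ 2 / 2
  have ht := key (a / (a + b + a)) ⟨by positivity, by rw [div_lt_one (by positivity)]; linarith⟩
  rw [div_mul_eq_mul_div, le_div_iff₀ (by positivity)] at ht
  nlinarith

/-- The proximal operator is firmly nonexpansive. -/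
theorem norm_sq_le_inner_of_isProx {g : E → ℝ} (hg : ConvexOn ℝ Set.univ g) {γ : ℝ} (hγ : 0 < γ)
    {p q u v : E}
    (hp : ∀ w, g p + (1 / (2 * γ)) * ‖p - u‖ ^ 2 ≤ g w + (1 / (2 * γ)) * ‖w - u‖ ^ 2)
    (hq : ∀ w, g q + (1 / (2 * γ)) * ‖q - v‖ ^ 2 ≤ g w + (1 / (2 * γ)) * ‖w - v‖ ^ 2) :
    ‖p - q‖ ^ 2 ≤ ⟪p - q, u - v⟫ := by
  have hpq := inner_sub_le_of_isProx hg hγ hp q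
  have hqp := inner_sub_le_of_isProx hg hγ hq p
  have hsum : ⟪p - u, q - p⟫ + ⟪q - v, p - q⟫ = ⟪p - q, u - v⟫ - ‖p - q‖ ^ 2 := by
    rw [← real_inner_self_eq_norm_sq]
    simp only [inner_sub_left, inner_sub_right, real_inner_comm]
    ring
  linarith

variable [CompleteSpace E]

theorem HasGradientAt.hasDerivAt_comp_add_smul {f : E → ℝ} {f' x v : E} {t : ℝ}
    (hf : HasGradientAt f f' (x + t • v)) :
    HasDerivAt (fun s : ℝ => f (x + s • v)) ⟪f', v⟫ t := by
  have hline : HasDerivAt (fun s : ℝ => x + s • v) v t := by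
    simpa using ((hasDerivAt_id t).smul_const v).const_add x
  simpa [Function.comp_def] using hf.hasFDerivAt.comp_hasDerivAt t hline

/-- A convex function lies above its tangent hyperplanes. -/
theorem ConvexOn.add_inner_le_of_hasGradientAt {f : E → ℝ} (hf : ConvexOn ℝ Set.univ f)
    {f' x : E} (hx : HasGradientAt f f' x) (y : E) : f x + ⟪f', y - x⟫ ≤ f y := by
  have hconv : ConvexOn ℝ Set.univ (fun s : ℝ => f (x + s • (y - x))) := by
    have := hf.comp_affineMap (AffineMap.lineMap x y : ℝ →ᵃ[ℝ] E)
    simpa [Function.comp_def, AffineMap.lineMap_apply, add_comm] using this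
  have hderiv : HasDerivAt (fun s : ℝ => f (x + s • (y - x))) ⟪f', y - x⟫ 0 :=
    HasGradientAt.hasDerivAt_comp_add_smul (by simpa using hx)
  have := hconv.le_slope_of_hasDerivAt (Set.mem_univ 0) (Set.mem_univ 1) one_pos hderiv
  simp [slope_def_field] at this
  linarith

/-- The descent lemma: a function with `L`-Lipschitz gradient lies below its quadratic upper
models. -/
theorem le_add_inner_add_norm_sq_of_lipschitz_gradient {f : E → ℝ} {f' : E → E} {L : ℝ}
    (hf : ∀ x, HasGradientAt f (f' x) x) (hlip : ∀ x y, ‖f' x - f' y‖ ≤ L * ‖x - y‖) (x y : E) :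
    f y ≤ f x + ⟪f' x, y - x⟫ + L / 2 * ‖y - x‖ ^ 2 := by
  set v := y - x with hv
  have hderiv (t : ℝ) : HasDerivAt
      (fun s : ℝ => f (x + s • v) - (s * ⟪f' x, v⟫ + L / 2 * ‖v‖ ^ 2 * s ^ 2))
      (⟪f' (x + t • v), v⟫ - (⟪f' x, v⟫ + L * ‖v‖ ^ 2 * t)) t := by
    have hquad := ((hasDerivAt_id t).mul_const ⟪f' x, v⟫).add
      ((hasDerivAt_pow 2 t).const_mul (L / 2 * ‖v‖ ^ 2))
    refine ((hf (x + t • v)).hasDerivAt_comp_add_smul.sub hquad).congr_deriv ?_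
    simp
    ring
  have hanti := antitoneOn_of_deriv_nonpos (convex_Icc (0 : ℝ) 1)
    (fun t _ => (hderiv t).continuousAt.continuousWithinAt)
    (fun t _ => (hderiv t).differentiableAt.differentiableWithinAt) (by
      intro t ht
      rw [interior_Icc] at ht
      rw [(hderiv t).deriv]
      have hgrad : ⟪f' (x + t • v) - f' x, v⟫ ≤ L * ‖v‖ ^ 2 * t :=
        calc ⟪f' (x + t • v) - f' x, v⟫ ≤ ‖f' (x + t • v) - f' x‖ * ‖v‖ := real_inner_le_norm _ _
          _ ≤ L * ‖x + t • v - x‖ * ‖v‖ := by gcongr; exact hlip _ _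
          _ = L * ‖v‖ ^ 2 * t := by
            rw [add_sub_cancel_left, norm_smul, Real.norm_of_nonneg ht.1.le]
            ring
      rw [inner_sub_left] at hgrad
      linarith)
  have := hanti (Set.left_mem_Icc.2 zero_le_one) (Set.right_mem_Icc.2 zero_le_one) zero_le_one
  simp [hv] at this
  linarith

/-- The Baillon–Haddad theorem: the `L`-Lipschitz gradient of a convex function is
`1 / L`-cocoercive. -/
theorem ConvexOn.norm_sq_le_inner_of_lipschitz_gradient {f : E → ℝ} {f' : E → E} {L : ℝ}
    (hL : 0 < L) (hconv : ConvexOn ℝ Set.univ f) (hf : ∀ x, HasGradientAt f (f' x) x)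
    (hlip : ∀ x y, ‖f' x - f' y‖ ≤ L * ‖x - y‖) (x y : E) :
    ‖f' x - f' y‖ ^ 2 ≤ L * ⟪x - y, f' x - f' y⟫ := by
  have key (x y : E) : f x + ⟪f' x, y - x⟫ + 1 / (2 * L) * ‖f' x - f' y‖ ^ 2 ≤ f y := by
    set d := f' x - f' y with hd
    have hlow := hconv.add_inner_le_of_hasGradientAt (hf x) (y + L⁻¹ • d)
    have hup := le_add_inner_add_norm_sq_of_lipschitz_gradient hf hlip y (y + L⁻¹ • d)
    have hsplit : ⟪f' x, y + L⁻¹ • d - x⟫ = ⟪f' x, y - x⟫ + L⁻¹ * ⟪f' x, d⟫ := by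
      rw [add_sub_right_comm, inner_add_right, inner_smul_right]
    rw [hsplit] at hlow
    rw [add_sub_cancel_left, inner_smul_right, norm_smul, mul_pow,
      Real.norm_of_nonneg (by positivity)] at hup
    have hdd : ⟪f' x, d⟫ - ⟪f' y, d⟫ = ‖d‖ ^ 2 := by
      rw [← inner_sub_left, ← hd, real_inner_self_eq_norm_sq]
    have hscale : L⁻¹ * (⟪f' x, d⟫ - ⟪f' y, d⟫) - L / 2 * (L⁻¹ ^ 2 * ‖d‖ ^ 2)
        = 1 / (2 * L) * ‖d‖ ^ 2 := by
      rw [hdd]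
      field_simp
      ring
    linarith
  have hxy := key x y
  have hyx := key y x
  rw [norm_sub_rev (f' y)] at hyx
  have hsum : ⟪f' x, y - x⟫ + ⟪f' y, x - y⟫ = -⟪x - y, f' x - f' y⟫ := by
    simp only [inner_sub_left, inner_sub_right, real_inner_comm]
    ring
  have hbound : 1 / L * ‖f' x - f' y‖ ^ 2 ≤ ⟪x - y, f' x - f' y⟫ := by
    have : 1 / L = 1 / (2 * L) + 1 / (2 * L) := by field_simp; norm_num
    rw [this, add_mul]
    linarith
  rwa [one_div_mul_eq_div, div_le_iff₀' hL] at hbound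

end ProximalGradient

/-- Composing a firmly nonexpansive step with a cocoercive forward step, at the level of
differences: `d` is the input, `h` the forward displacement and `e` the output. -/
theorem norm_sq_add_mul_norm_sub_sq_le {E : Type*} [NormedAddCommGroup E] [InnerProductSpace ℝ E]
    {d e h : E} {m : ℝ} (hm : m ≤ 1) (hm' : 1 / 2 ≤ m) (hprox : ‖e‖ ^ 2 ≤ ⟪e, d - h⟫)
    (hcoco : m * ‖h‖ ^ 2 ≤ ⟪d, h⟫) :
    ‖e‖ ^ 2 + (m - 1 / 2) * ‖d - e‖ ^ 2 ≤ ‖d‖ ^ 2 := by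
  have hu : ‖d - h - e‖ ^ 2 = ‖d‖ ^ 2 - 2 * ⟪d, h⟫ + ‖h‖ ^ 2 - 2 * ⟪e, d - h⟫ + ‖e‖ ^ 2 := by
    rw [norm_sub_sq_real, norm_sub_sq_real, real_inner_comm e]
  have hsum : ‖d - e‖ ^ 2 = ‖d - h - e‖ ^ 2 + 2 * ⟪d - h - e, h⟫ + ‖h‖ ^ 2 := by
    rw [← norm_add_sq_real]
    congr 2
    abel
  have hdiff : 0 ≤ ‖d - h - e‖ ^ 2 - 2 * ((2 * m - 1) * ⟪d - h - e, h⟫)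
      + (2 * m - 1) ^ 2 * ‖h‖ ^ 2 := by
    have := norm_sub_sq_real (d - h - e) ((2 * m - 1) • h)
    rw [inner_smul_right, norm_smul, mul_pow, Real.norm_eq_abs, sq_abs] at this
    rw [← this]
    positivity
  nlinarith [sq_nonneg ‖d - h - e‖, sq_nonneg ‖h‖,
    mul_nonneg (sub_nonneg.2 hm) (sq_nonneg ‖d - h - e‖),
    mul_nonneg (mul_nonneg (sub_nonneg.2 hm) (sub_nonneg.2 hm')) (sq_nonneg ‖h‖)]

theorem stmt_0
    (n : ℕ) (hn : 0 < n)
    (L γ : ℝ) (hL : 0 < L) (hγ : 0 < γ) (hγ2 : γ < 2 / L)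
    (f g : EuclideanSpace ℝ (Fin n) → ℝ)
    (f' : EuclideanSpace ℝ (Fin n) → EuclideanSpace ℝ (Fin n))
    (hf_conv : ConvexOn ℝ Set.univ f)
    (hf_diff : ∀ x, HasGradientAt f (f' x) x)
    (hf_lip : ∀ x y, ‖f' x - f' y‖ ≤ L * ‖x - y‖)
    (hg_conv : ConvexOn ℝ Set.univ g)
    (hmin : ∃ z, ∀ w, f z + g z ≤ f w + g w)
    (T : EuclideanSpace ℝ (Fin n) → EuclideanSpace ℝ (Fin n))
    (hT : ∀ x w, g (T x) + (1 / (2 * γ)) * ‖T x - (x - γ • f' x)‖ ^ 2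
        ≤ g w + (1 / (2 * γ)) * ‖w - (x - γ • f' x)‖ ^ 2)
    (ν : ℝ) (hν : ν = 2 / (1 + 2 * min 1 (1 / (γ * L)))) :
    ∀ x y, ‖T x - T y‖ ^ 2
        + ((1 - ν) / ν) * ‖(x - T x) - (y - T y)‖ ^ 2
      ≤ ‖x - y‖ ^ 2 := by
  intro x y
  have hγL : γ * L < 2 := (lt_div_iff₀ hL).1 hγ2
  have hγL0 : 0 < γ * L := mul_pos hγ hL
  set m := min 1 (1 / (γ * L)) with hm
  have hm1 : m ≤ 1 := min_le_left _ _
  have hm2 : 1 / 2 ≤ m := le_min (by norm_num) (one_div_le_one_div_of_le hγL0 hγL.le)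
  have hνm : (1 - ν) / ν = m - 1 / 2 := by
    have : 1 + 2 * m ≠ 0 := by positivity
    rw [hν]
    field_simp
    ring
  rw [hνm, show (x - T x) - (y - T y) = (x - y) - (T x - T y) by abel]
  refine norm_sq_add_mul_norm_sub_sq_le (h := γ • (f' x - f' y)) hm1 hm2 ?_ ?_
  · rw [show x - y - γ • (f' x - f' y) = (x - γ • f' x) - (y - γ • f' y) by module]
    exact norm_sq_le_inner_of_isProx hg_conv hγ (hT x) (hT y)
  · have hcoco := hf_conv.norm_sq_le_inner_of_lipschitz_gradient hL hf_diff hf_lip x y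
    calc m * ‖γ • (f' x - f' y)‖ ^ 2 ≤ 1 / (γ * L) * ‖γ • (f' x - f' y)‖ ^ 2 := by
          gcongr
          exact min_le_right _ _
      _ = γ / L * ‖f' x - f' y‖ ^ 2 := by
          rw [norm_smul, Real.norm_of_nonneg hγ.le]
          field_simp
      _ ≤ γ / L * (L * ⟪x - y, f' x - f' y⟫) := by gcongr
      _ = ⟪x - y, γ • (f' x - f' y)⟫ := by
          rw [inner_smul_right]
          field_simp
end

section
/- Let γ ∈ (0, 2/L) and let T be a proximal-gradient map for (f, g, γ). Then for every x ∈ ℝⁿ: F(T x) ≤ F(x) − ((2 − γL)/(2γ))·‖T x − x‖², and moreover there exists a subgradient v of F at T x such that F(T x) ≤ F(x) − ((2 − γL)γ/(2(1 + γL)²))·‖v‖². -/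
open scoped RealInnerProductSpace

section ProximalGradient

variable {E : Type*} [NormedAddCommGroup E] [InnerProductSpace ℝ E]

/-- Derivative of a differentiable function along the segment from `x` to `y`. -/
theorem HasGradientAt.hasDerivAt_comp_lineMap [CompleteSpace E] {f : E → ℝ} {v x y : E} {t : ℝ}
    (hf : HasGradientAt f v (AffineMap.lineMap x y t)) :
    HasDerivAt (fun s : ℝ => f (AffineMap.lineMap x y s)) ⟪v, y - x⟫ t := by
  simpa [Function.comp_def] using hf.hasFDerivAt.comp_hasDerivAt t (AffineMap.hasDerivAt_lineMap (a := x) (b := y))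

/-- The gradient of a convex function is a subgradient. -/
theorem ConvexOn.add_inner_gradient_le [CompleteSpace E] {f : E → ℝ} {v x : E}
    (hf : ConvexOn ℝ Set.univ f) (hv : HasGradientAt f v x) (y : E) :
    f x + ⟪v, y - x⟫ ≤ f y := by
  have hconv : ConvexOn ℝ Set.univ (fun s : ℝ => f (AffineMap.lineMap x y s)) :=
    hf.comp_affineMap (AffineMap.lineMap x y)
  have hder : HasDerivAt (fun s : ℝ => f (AffineMap.lineMap x y s)) ⟪v, y - x⟫ 0 :=
    HasGradientAt.hasDerivAt_comp_lineMap (by simpa using hv)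
  have hslope := hconv.le_slope_of_hasDerivAt (Set.mem_univ 0) (Set.mem_univ 1) one_pos hder
  simp [slope_def_field] at hslope
  linarith

/-- The descent lemma: quadratic upper bound for a function with Lipschitz gradient. -/
theorem le_add_inner_add_sq_of_lipschitz_gradient [CompleteSpace E] {f : E → ℝ} {f' : E → E}
    {L : ℝ} (hf : ∀ x, HasGradientAt f (f' x) x)
    (hlip : ∀ x y, ‖f' x - f' y‖ ≤ L * ‖x - y‖) (x y : E) :
    f y ≤ f x + ⟪f' x, y - x⟫ + L / 2 * ‖y - x‖ ^ 2 := by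
  have hder : ∀ t : ℝ, HasDerivAt
      (fun s : ℝ => f (AffineMap.lineMap x y s)
        - (s * ⟪f' x, y - x⟫ + s ^ 2 * (L / 2 * ‖y - x‖ ^ 2)))
      (⟪f' (AffineMap.lineMap x y t), y - x⟫ - (⟪f' x, y - x⟫ + t * (L * ‖y - x‖ ^ 2))) t := by
    intro t
    have hquad := ((hasDerivAt_id t).mul_const ⟪f' x, y - x⟫).add
      ((hasDerivAt_pow 2 t).mul_const (L / 2 * ‖y - x‖ ^ 2))
    refine ((hf (AffineMap.lineMap x y t)).hasDerivAt_comp_lineMap.sub hquad).congr_deriv ?_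
    norm_num
    ring
  have hanti := antitoneOn_of_deriv_nonpos (convex_Icc (0 : ℝ) 1)
    (fun t _ => (hder t).continuousAt.continuousWithinAt)
    (fun t _ => (hder t).differentiableAt.differentiableWithinAt) (by
      intro t ht
      rw [interior_Icc] at ht
      rw [(hder t).deriv]
      have hnorm : ‖f' (AffineMap.lineMap x y t) - f' x‖ ≤ L * (t * ‖y - x‖) := by
        have hdist : ‖AffineMap.lineMap x y t - x‖ = t * ‖y - x‖ := by
          simp [AffineMap.lineMap_apply, norm_smul, abs_of_pos ht.1]
        exact hdist ▸ hlip (AffineMap.lineMap x y t) x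
      have hinner := (real_inner_le_norm (f' (AffineMap.lineMap x y t) - f' x) (y - x)).trans
        (mul_le_mul_of_nonneg_right hnorm (norm_nonneg _))
      rw [inner_sub_left] at hinner
      linarith)
  have hends := hanti (Set.left_mem_Icc.2 zero_le_one) (Set.right_mem_Icc.2 zero_le_one) zero_le_one
  simp at hends
  linarith

/-- Optimality condition for a proximal point: `2 * c • (z - p)` is a subgradient at `p`. -/
theorem ConvexOn.add_inner_le_of_prox {g : E → ℝ} (hg : ConvexOn ℝ Set.univ g) {c : ℝ} {p z : E}
    (hp : ∀ w, g p + c * ‖p - z‖ ^ 2 ≤ g w + c * ‖w - z‖ ^ 2) (y : E) :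
    g p + 2 * c * ⟪z - p, y - p⟫ ≤ g y := by
  have hsmall : ∀ t ∈ Set.Ioo (0 : ℝ) 1,
      0 ≤ g y - g p - 2 * c * ⟪z - p, y - p⟫ + t * (c * ‖y - p‖ ^ 2) := by
    intro t ht
    have hconv := hg.2 (Set.mem_univ p) (Set.mem_univ y) (sub_nonneg.2 ht.2.le) ht.1.le
      (sub_add_cancel 1 t)
    have hprox := hp ((1 - t) • p + t • y)
    have hdecomp : (1 - t) • p + t • y - z = t • (y - p) - (z - p) := by module
    have hnorm : ‖p - z‖ = ‖z - p‖ := norm_sub_rev p z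
    rw [hdecomp, norm_sub_sq_real (t • (y - p)), norm_smul, mul_pow, Real.norm_eq_abs, sq_abs,
      real_inner_smul_left, real_inner_comm, hnorm] at hprox
    simp only [smul_eq_mul] at hconv
    refine nonneg_of_mul_nonneg_right ?_ ht.1
    linarith
  have htendsto : Filter.Tendsto
      (fun t : ℝ => g y - g p - 2 * c * ⟪z - p, y - p⟫ + t * (c * ‖y - p‖ ^ 2))
      (nhdsWithin 0 (Set.Ioi 0)) (nhds (g y - g p - 2 * c * ⟪z - p, y - p⟫)) := by
    refine tendsto_nhdsWithin_of_tendsto_nhds ?_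
    refine Continuous.tendsto' (by fun_prop) _ _ (by simp)
  have hlim := ge_of_tendsto htendsto
    (Filter.mem_of_superset (Ioo_mem_nhdsGT one_pos) hsmall)
  linarith

end ProximalGradient

theorem stmt_3
    (n : ℕ) (hn : 0 < n)
    (L γ : ℝ) (hL : 0 < L) (hγ : 0 < γ) (hγ2 : γ < 2 / L)
    (f g : EuclideanSpace ℝ (Fin n) → ℝ)
    (f' : EuclideanSpace ℝ (Fin n) → EuclideanSpace ℝ (Fin n))
    (hf_conv : ConvexOn ℝ Set.univ f)
    (hf_diff : ∀ x, HasGradientAt f (f' x) x)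
    (hf_lip : ∀ x y, ‖f' x - f' y‖ ≤ L * ‖x - y‖)
    (hg_conv : ConvexOn ℝ Set.univ g)
    (hmin : ∃ z, ∀ w, f z + g z ≤ f w + g w)
    (T : EuclideanSpace ℝ (Fin n) → EuclideanSpace ℝ (Fin n))
    (hT : ∀ x w, g (T x) + (1 / (2 * γ)) * ‖T x - (x - γ • f' x)‖ ^ 2
        ≤ g w + (1 / (2 * γ)) * ‖w - (x - γ • f' x)‖ ^ 2) :
    ∀ x, (f (T x) + g (T x)
            ≤ (f x + g x) - ((2 - γ * L) / (2 * γ)) * ‖T x - x‖ ^ 2)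
      ∧ ∃ v, (∀ y, f y + g y ≥ (f (T x) + g (T x)) + ⟪v, y - T x⟫)
          ∧ f (T x) + g (T x)
              ≤ (f x + g x) - ((2 - γ * L) * γ / (2 * (1 + γ * L) ^ 2)) * ‖v‖ ^ 2 := by
  intro x
  have hprox : ∀ y, g (T x) + ⟪γ⁻¹ • (x - T x) - f' x, y - T x⟫ ≤ g y := by
    intro y
    have hscale : 2 * (1 / (2 * γ)) * ⟪x - γ • f' x - T x, y - T x⟫
        = ⟪γ⁻¹ • (x - T x) - f' x, y - T x⟫ := by
      simp only [inner_sub_left, real_inner_smul_left]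
      field_simp
      ring
    exact hscale ▸ hg_conv.add_inner_le_of_prox (hT x) y
  have hdescent : f (T x) + g (T x)
      ≤ (f x + g x) - ((2 - γ * L) / (2 * γ)) * ‖T x - x‖ ^ 2 := by
    have hsmooth := le_add_inner_add_sq_of_lipschitz_gradient hf_diff hf_lip x (T x)
    have hsub := hprox x
    rw [inner_sub_left, real_inner_smul_left, real_inner_self_eq_norm_sq, norm_sub_rev,
      ← neg_sub (T x) x, inner_neg_right] at hsub
    have hcoef : (2 - γ * L) / (2 * γ) = γ⁻¹ - L / 2 := by field_simp
    rw [hcoef]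
    linarith
  refine ⟨hdescent, γ⁻¹ • (x - T x) - f' x + f' (T x), fun y => ?_, ?_⟩
  · have hgrad := hf_conv.add_inner_gradient_le (hf_diff (T x)) y
    rw [inner_add_left]
    linarith [hprox y]
  · refine hdescent.trans (sub_le_sub_left ?_ _)
    have hnorm : ‖γ⁻¹ • (x - T x) - f' x + f' (T x)‖ ≤ (1 + γ * L) / γ * ‖T x - x‖ := by
      calc ‖γ⁻¹ • (x - T x) - f' x + f' (T x)‖
          = ‖γ⁻¹ • (x - T x) + (f' (T x) - f' x)‖ := by congr 1; abel
        _ ≤ γ⁻¹ * ‖T x - x‖ + L * ‖T x - x‖ := by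
            refine (norm_add_le _ _).trans (add_le_add ?_ (hf_lip _ _))
            rw [norm_smul, Real.norm_of_nonneg (inv_nonneg.2 hγ.le), norm_sub_rev]
        _ = (1 + γ * L) / γ * ‖T x - x‖ := by field_simp
    have hpos : 0 < 2 - γ * L := sub_pos.2 ((lt_div_iff₀ hL).1 hγ2)
    have hfac : 0 < 1 + γ * L := by positivity
    calc (2 - γ * L) * γ / (2 * (1 + γ * L) ^ 2) * ‖γ⁻¹ • (x - T x) - f' x + f' (T x)‖ ^ 2
        ≤ (2 - γ * L) * γ / (2 * (1 + γ * L) ^ 2) * ((1 + γ * L) / γ * ‖T x - x‖) ^ 2 := by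
          gcongr
      _ = (2 - γ * L) / (2 * γ) * ‖T x - x‖ ^ 2 := by field_simp
end

section
/- Let γ ∈ (0, 2/L), let T be a proximal-gradient map for (f, g, γ), and let (α_k) satisfy 0 ≤ α_k ≤ min{1, 1/(γL)} − 1/2 for all k. Then the alternated-inertia sequence (y_{2k}) converges to some point of X⋆, and it is Fejér monotone with respect to X⋆: for every x⋆ ∈ X⋆ and every k, ‖y_{2k+2} − x⋆‖ ≤ ‖y_{2k} − x⋆‖. -/
open scoped RealInnerProductSpace
open Filter

section

variable {E : Type*} [NormedAddCommGroup E] [InnerProductSpace ℝ E]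

/-- First-order optimality: if `p` minimizes `g + h` with `g` convex and `h` has derivative `s` at
`p` in the direction `w - p`, then `g p - s ≤ g w`. -/
theorem ConvexOn.sub_le_of_forall_add_le {g h : E → ℝ} (hg : ConvexOn ℝ Set.univ g)
    {p w : E} {s : ℝ} (hmin : ∀ z, g p + h p ≤ g z + h z)
    (hs : HasDerivAt (fun t : ℝ => h (p + t • (w - p))) s 0) :
    g p - s ≤ g w := by
  have hder : HasDerivAt (fun t : ℝ => h (p + t • (w - p)) + t * (g w - g p))
      (s + 1 * (g w - g p)) 0 := hs.add ((hasDerivAt_id 0).mul_const _)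
  have hlim := hder.tendsto_slope_zero_right
  have hnonneg : 0 ≤ s + 1 * (g w - g p) := by
    refine ge_of_tendsto hlim ?_
    filter_upwards [Ioo_mem_nhdsGT (zero_lt_one (α := ℝ))] with t ht
    have hconv := hg.2 (Set.mem_univ p) (Set.mem_univ w) (sub_nonneg.2 ht.2.le) ht.1.le
      (by ring)
    have hpt : (1 - t) • p + t • w = p + t • (w - p) := by module
    rw [hpt] at hconv
    have hm := hmin (p + t • (w - p))
    simp only [smul_eq_mul] at hconv
    simp only [zero_add, zero_smul, add_zero, zero_mul, smul_eq_mul]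
    exact mul_nonneg (inv_nonneg.2 ht.1.le) (by linarith)
  linarith

/-- The variational inequality satisfied by a minimizer `q` of `g + ‖· - u‖² / (2γ)`. -/
theorem ConvexOn.inner_le_of_isProx {g : E → ℝ} (hg : ConvexOn ℝ Set.univ g) {γ : ℝ} (hγ : 0 < γ)
    {u q : E}
    (hq : ∀ w, g q + (1 / (2 * γ)) * ‖q - u‖ ^ 2 ≤ g w + (1 / (2 * γ)) * ‖w - u‖ ^ 2) (w : E) :
    ⟪u - q, w - q⟫ ≤ γ * (g w - g q) := by
  have hline : HasDerivAt (fun t : ℝ => q + t • (w - q) - u) ((1 : ℝ) • (w - q)) 0 :=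
    (((hasDerivAt_id (0 : ℝ)).smul_const (w - q)).const_add q).sub_const u
  have hkey := hg.sub_le_of_forall_add_le (h := fun w => (1 / (2 * γ)) * ‖w - u‖ ^ 2) hq
    (hline.norm_sq.const_mul (1 / (2 * γ)))
  simp only [zero_smul, add_zero, one_smul] at hkey
  have hneg : ⟪u - q, w - q⟫ = -⟪q - u, w - q⟫ := by rw [← inner_neg_left, neg_sub]
  have hscale : γ * (1 / (2 * γ) * (2 * ⟪q - u, w - q⟫)) = ⟪q - u, w - q⟫ := by
    field_simp
  nlinarith [mul_le_mul_of_nonneg_left hkey hγ.le]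

variable [CompleteSpace E]

theorem HasGradientAt.hasDerivAt_line {f : E → ℝ} {v p d : E} {t : ℝ}
    (hf : HasGradientAt f v (p + t • d)) :
    HasDerivAt (fun t : ℝ => f (p + t • d)) ⟪v, d⟫ t := by
  have hline : HasDerivAt (fun t : ℝ => p + t • d) ((1 : ℝ) • d) t :=
    ((hasDerivAt_id t).smul_const d).const_add p
  simpa [Function.comp_def] using hf.hasFDerivAt.comp_hasDerivAt t hline

/-- First-order optimality for the sum of a convex and a differentiable function. -/
theorem ConvexOn.sub_inner_le_of_forall_add_le {g h : E → ℝ} (hg : ConvexOn ℝ Set.univ g)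
    {p v : E} (hv : HasGradientAt h v p) (hmin : ∀ z, g p + h p ≤ g z + h z) (w : E) :
    g p - ⟪v, w - p⟫ ≤ g w :=
  hg.sub_le_of_forall_add_le hmin (HasGradientAt.hasDerivAt_line (by simpa using hv))

theorem ConvexOn.add_inner_le {f : E → ℝ} (hf : ConvexOn ℝ Set.univ f) {p v : E}
    (hv : HasGradientAt f v p) (w : E) : f p + ⟪v, w - p⟫ ≤ f w := by
  have hder : HasDerivAt (fun t : ℝ => f (p + t • (w - p))) ⟪v, w - p⟫ 0 :=
    HasGradientAt.hasDerivAt_line (by simpa using hv)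
  have := hf.sub_le_of_forall_add_le (h := fun z => -f z) (by simp) hder.neg
  linarith

/-- The descent lemma. -/
theorem le_add_inner_of_lipschitz_gradient {f : E → ℝ} {f' : E → E} {L : ℝ}
    (hf : ∀ x, HasGradientAt f (f' x) x) (hlip : ∀ x y, ‖f' x - f' y‖ ≤ L * ‖x - y‖) (p d : E) :
    f (p + d) ≤ f p + ⟪f' p, d⟫ + L / 2 * ‖d‖ ^ 2 := by
  have hder (t : ℝ) : HasDerivAt
      (fun t : ℝ => f (p + t • d) - t * ⟪f' p, d⟫ - t ^ 2 * (L / 2 * ‖d‖ ^ 2))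
      (⟪f' (p + t • d), d⟫ - 1 * ⟪f' p, d⟫ - (2 * t) * (L / 2 * ‖d‖ ^ 2)) t := by
    have hsq : HasDerivAt (fun t : ℝ => t ^ 2) (2 * t) t := by simpa using hasDerivAt_pow 2 t
    exact ((hf _).hasDerivAt_line.sub ((hasDerivAt_id t).mul_const _)).sub (hsq.mul_const _)
  have hanti := antitoneOn_of_hasDerivWithinAt_nonpos (convex_Icc (0 : ℝ) 1)
    (fun t _ => (hder t).continuousAt.continuousWithinAt)
    (fun t _ => (hder t).hasDerivWithinAt) (fun t ht => by
      rw [interior_Icc] at ht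
      have hcs := real_inner_le_norm (f' (p + t • d) - f' p) d
      have hl := hlip (p + t • d) p
      rw [add_sub_cancel_left, norm_smul, Real.norm_of_nonneg ht.1.le] at hl
      rw [inner_sub_left] at hcs
      nlinarith [mul_le_mul_of_nonneg_right hl (norm_nonneg d)])
  have := hanti (Set.left_mem_Icc.2 zero_le_one) (Set.right_mem_Icc.2 zero_le_one) zero_le_one
  simp only [one_smul, zero_smul, add_zero] at this
  linarith

theorem ConvexOn.norm_gradient_sub_sq_le {f : E → ℝ} {f' : E → E} {L : ℝ} (hL : 0 < L)
    (hconv : ConvexOn ℝ Set.univ f) (hf : ∀ x, HasGradientAt f (f' x) x)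
    (hlip : ∀ x y, ‖f' x - f' y‖ ≤ L * ‖x - y‖) (x p : E) :
    ‖f' x - f' p‖ ^ 2 ≤ 2 * L * (f x - f p - ⟪f' p, x - p⟫) := by
  set d := f' x - f' p with hd
  have hdesc := le_add_inner_of_lipschitz_gradient hf hlip x (-(L⁻¹ • d))
  have hlow := hconv.add_inner_le (hf p) (x + -(L⁻¹ • d))
  have hpt : x + -(L⁻¹ • d) - p = (x - p) - L⁻¹ • d := by abel
  rw [hpt, inner_sub_right, real_inner_smul_right] at hlow
  rw [inner_neg_right, real_inner_smul_right, norm_neg, norm_smul, Real.norm_of_nonneg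
    (inv_nonneg.2 hL.le)] at hdesc
  have hdd : ⟪f' x, d⟫ - ⟪f' p, d⟫ = ‖d‖ ^ 2 := by
    rw [← inner_sub_left, ← hd, real_inner_self_eq_norm_sq]
  have hsum : L⁻¹ * (‖d‖ ^ 2) - L / 2 * (L⁻¹ * ‖d‖) ^ 2 ≤ f x - f p - ⟪f' p, x - p⟫ := by
    rw [← hdd]; linarith
  have hL2 : 2 * L * (L⁻¹ * (‖d‖ ^ 2) - L / 2 * (L⁻¹ * ‖d‖) ^ 2) = ‖d‖ ^ 2 := by
    field_simp; ring
  nlinarith [mul_le_mul_of_nonneg_left hsum (by positivity : 0 ≤ 2 * L)]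

/-- The Baillon–Haddad theorem: the gradient of a convex `L`-smooth function is cocoercive. -/
theorem ConvexOn.norm_gradient_sub_sq_le_inner {f : E → ℝ} {f' : E → E} {L : ℝ} (hL : 0 < L)
    (hconv : ConvexOn ℝ Set.univ f) (hf : ∀ x, HasGradientAt f (f' x) x)
    (hlip : ∀ x y, ‖f' x - f' y‖ ≤ L * ‖x - y‖) (x p : E) :
    ‖f' x - f' p‖ ^ 2 ≤ L * ⟪f' x - f' p, x - p⟫ := by
  have hxp := hconv.norm_gradient_sub_sq_le hL hf hlip x p
  have hpx := hconv.norm_gradient_sub_sq_le hL hf hlip p x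
  have hneg : ⟪f' x, p - x⟫ = -⟪f' x, x - p⟫ := by rw [← inner_neg_right, neg_sub]
  rw [norm_sub_rev, hneg] at hpx
  rw [inner_sub_left]
  linarith

/-- A proximal-gradient step decreases the squared distance to every minimizer by a multiple of
the squared residual. -/
theorem norm_proxGrad_sub_sq_le {f g : E → ℝ} {f' : E → E} {L γ : ℝ} (hL : 0 < L) (hγ : 0 < γ)
    (hf_conv : ConvexOn ℝ Set.univ f) (hf : ∀ x, HasGradientAt f (f' x) x)
    (hlip : ∀ x y, ‖f' x - f' y‖ ≤ L * ‖x - y‖) (hg : ConvexOn ℝ Set.univ g) {x q p : E}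
    (hq : ∀ w, g q + (1 / (2 * γ)) * ‖q - (x - γ • f' x)‖ ^ 2
      ≤ g w + (1 / (2 * γ)) * ‖w - (x - γ • f' x)‖ ^ 2)
    (hp : ∀ w, f p + g p ≤ f w + g w) :
    ‖q - p‖ ^ 2 ≤ ‖x - p‖ ^ 2 - (1 - γ * L / 2) * ‖x - q‖ ^ 2 := by
  have hprox := hg.inner_le_of_isProx hγ hq p
  have hopt := hg.sub_inner_le_of_forall_add_le (hf p)
    (fun z => by linarith [hp z]) q
  have hcoc := hf_conv.norm_gradient_sub_sq_le_inner hL hf hlip x p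
  set d := f' x - f' p with hd
  have hvar : ⟪x - γ • f' x - q, p - q⟫ = -⟪x - q, q - p⟫ + γ * ⟪f' x, q - p⟫ := by
    rw [← neg_sub q p, inner_neg_right, show x - γ • f' x - q = (x - q) - γ • f' x by abel,
      inner_sub_left, real_inner_smul_left]
    ring
  have hsplit : ⟪d, x - p⟫ = ⟪f' x, q - p⟫ - ⟪f' p, q - p⟫ + ⟪d, x - q⟫ := by
    rw [← inner_sub_left, ← hd, ← inner_add_right]
    congr 1
    abel
  have hexp : ‖x - p‖ ^ 2 = ‖x - q‖ ^ 2 + 2 * ⟪x - q, q - p⟫ + ‖q - p‖ ^ 2 := by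
    rw [← norm_add_sq_real, sub_add_sub_cancel]
  -- Completing the square absorbs the cross term `⟪d, x - q⟫`.
  have hsq : 0 ≤ ‖d‖ ^ 2 - L * ⟪d, x - q⟫ + L ^ 2 / 4 * ‖x - q‖ ^ 2 := by
    have h := sq_nonneg ‖d - (L / 2) • (x - q)‖
    rw [norm_sub_sq_real, real_inner_smul_right, norm_smul,
      Real.norm_of_nonneg (by positivity)] at h
    linarith
  have hmono : 0 ≤ ⟪f' x, q - p⟫ - ⟪f' p, q - p⟫ + L / 4 * ‖x - q‖ ^ 2 := by
    refine nonneg_of_mul_nonneg_right (?_ : 0 ≤ L * _) hL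
    rw [hsplit] at hcoc
    linarith
  have hγopt := mul_le_mul_of_nonneg_left hopt hγ.le
  have hγmono := mul_nonneg hγ.le hmono
  linarith

/-- If the points of a residual-vanishing sequence converge, the limit minimizes `f + g`. -/
theorem forall_add_le_of_tendsto_proxGrad {f g : E → ℝ} {f' : E → E} {γ : ℝ} (hγ : 0 < γ)
    (hf_conv : ConvexOn ℝ Set.univ f) (hf : ∀ x, HasGradientAt f (f' x) x)
    (hf' : Continuous f') (hg : ConvexOn ℝ Set.univ g) (hg' : Continuous g) {x q : ℕ → E} {p : E}
    (hq : ∀ k w, g (q k) + (1 / (2 * γ)) * ‖q k - (x k - γ • f' (x k))‖ ^ 2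
      ≤ g w + (1 / (2 * γ)) * ‖w - (x k - γ • f' (x k))‖ ^ 2)
    (hx : Tendsto x atTop (nhds p)) (hqp : Tendsto q atTop (nhds p)) (w : E) :
    f p + g p ≤ f w + g w := by
  have hlow := hf_conv.add_inner_le (hf p) w
  have hlim : ⟪p - γ • f' p - p, w - p⟫ ≤ γ * (g w - g p) :=
    le_of_tendsto_of_tendsto'
      (((hx.sub (((hf'.tendsto p).comp hx).const_smul γ)).sub hqp).inner
        (tendsto_const_nhds.sub hqp))
      ((tendsto_const_nhds.sub ((hg'.tendsto p).comp hqp)).const_mul γ)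
      (fun k => hg.inner_le_of_isProx hγ (hq k) w)
  rw [sub_sub_cancel_left, inner_neg_left, real_inner_smul_left] at hlim
  have : -⟪f' p, w - p⟫ ≤ g w - g p := le_of_mul_le_mul_left (by linarith) hγ
  linarith

end

/-- A sequence whose distance to a cluster point is nonincreasing converges to that point. -/
theorem tendsto_of_antitone_dist_of_subseq {X : Type*} [PseudoMetricSpace X] {u : ℕ → X} {p : X}
    (hu : Antitone fun k => dist (u k) p) {φ : ℕ → ℕ}
    (hφ : Tendsto (u ∘ φ) atTop (nhds p)) : Tendsto u atTop (nhds p) := by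
  rw [Metric.tendsto_atTop] at hφ ⊢
  intro ε hε
  obtain ⟨N, hN⟩ := hφ ε hε
  exact ⟨φ N, fun k hk => (hu hk).trans_lt (hN N le_rfl)⟩

/-- Nonnegative quantities dominated by the decrements of a nonnegative sequence vanish. -/
theorem tendsto_zero_of_le_sub_succ {a r : ℕ → ℝ} (ha : ∀ k, 0 ≤ a k) (hr : ∀ k, 0 ≤ r k)
    (h : ∀ k, r k ≤ a k - a (k + 1)) : Tendsto r atTop (nhds 0) := by
  have hanti : Antitone a := antitone_nat_of_succ_le fun k => by linarith [h k, hr k]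
  have hlim := tendsto_atTop_ciInf hanti ⟨0, by rintro _ ⟨k, rfl⟩; exact ha k⟩
  have hdiff := hlim.sub (hlim.comp (tendsto_add_atTop_nat 1))
  rw [sub_self] at hdiff
  exact squeeze_zero hr h hdiff

/-- The squared distance from an extrapolated point does not exceed the original one when the
extrapolation coefficient is at most the averagedness constant. -/
theorem norm_extrapolate_sub_sq_le {E : Type*} [NormedAddCommGroup E] [InnerProductSpace ℝ E]
    {y q p : E} {a c : ℝ} (ha : 0 ≤ a) (hac : a ≤ c)
    (h : ‖q - p‖ ^ 2 ≤ ‖y - p‖ ^ 2 - c * ‖y - q‖ ^ 2) :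
    ‖q + a • (q - y) - p‖ ^ 2 ≤ ‖y - p‖ ^ 2 := by
  have hy : ‖y - p‖ ^ 2 = ‖q - p‖ ^ 2 - 2 * ⟪q - p, q - y⟫ + ‖q - y‖ ^ 2 := by
    rw [← norm_sub_sq_real, sub_sub_sub_cancel_left]
  have hx : ‖q + a • (q - y) - p‖ ^ 2
      = ‖q - p‖ ^ 2 + 2 * (a * ⟪q - p, q - y⟫) + a ^ 2 * ‖q - y‖ ^ 2 := by
    rw [show q + a • (q - y) - p = (q - p) + a • (q - y) by abel, norm_add_sq_real,
      real_inner_smul_right, norm_smul, Real.norm_of_nonneg ha, mul_pow]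
  rw [norm_sub_rev y q] at h
  have hgap : (1 + a) * (c - a) * ‖q - y‖ ^ 2 ≥ 0 :=
    mul_nonneg (mul_nonneg (by linarith) (by linarith)) (sq_nonneg _)
  nlinarith [mul_le_mul_of_nonneg_left h (by linarith : 0 ≤ 1 + a)]

theorem min_one_div_sub_half_le {s : ℝ} (hs : 0 < s) (hs2 : s ≤ 2) :
    min 1 (1 / s) - 1 / 2 ≤ 1 - s / 2 := by
  rcases le_total s 1 with h | h
  · linarith [min_le_left 1 (1 / s)]
  · have : 1 / s ≤ 3 / 2 - s / 2 := by
      rw [div_le_iff₀ hs]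
      nlinarith
    linarith [min_le_right 1 (1 / s)]

theorem stmt_4
    (n : ℕ) (hn : 0 < n)
    (L γ : ℝ) (hL : 0 < L) (hγ : 0 < γ) (hγ2 : γ < 2 / L)
    (f g : EuclideanSpace ℝ (Fin n) → ℝ)
    (f' : EuclideanSpace ℝ (Fin n) → EuclideanSpace ℝ (Fin n))
    (hf_conv : ConvexOn ℝ Set.univ f)
    (hf_diff : ∀ x, HasGradientAt f (f' x) x)
    (hf_lip : ∀ x y, ‖f' x - f' y‖ ≤ L * ‖x - y‖)
    (hg_conv : ConvexOn ℝ Set.univ g)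
    (hmin : ∃ z, ∀ w, f z + g z ≤ f w + g w)
    (T : EuclideanSpace ℝ (Fin n) → EuclideanSpace ℝ (Fin n))
    (hT : ∀ x w, g (T x) + (1 / (2 * γ)) * ‖T x - (x - γ • f' x)‖ ^ 2
        ≤ g w + (1 / (2 * γ)) * ‖w - (x - γ • f' x)‖ ^ 2)
    (α : ℕ → ℝ)
    (hα : ∀ k, 0 ≤ α k ∧ α k ≤ min 1 (1 / (γ * L)) - 1 / 2)
    (x₀ : EuclideanSpace ℝ (Fin n))
    (x y : ℕ → EuclideanSpace ℝ (Fin n))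
    (hy0 : y 0 = x₀) (hx0 : x 0 = x₀)
    (hseq : ∀ k, Even k →
        y (k + 1) = T (x k)
      ∧ x (k + 1) = y (k + 1) + α k • (y (k + 1) - y k)
      ∧ y (k + 2) = T (x (k + 1))
      ∧ x (k + 2) = y (k + 2)) :
    (∃ p, (∀ w, f p + g p ≤ f w + g w)
        ∧ Tendsto (fun k => y (2 * k)) atTop (nhds p))
    ∧ ∀ xstar, (∀ w, f xstar + g xstar ≤ f w + g w) →
        ∀ k, ‖y (2 * k + 2) - xstar‖ ≤ ‖y (2 * k) - xstar‖ := by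
  have hs2 : γ * L < 2 := by rwa [lt_div_iff₀ hL] at hγ2
  have hc : 0 < 1 - γ * L / 2 := by linarith
  have hxy (k : ℕ) : x (2 * k) = y (2 * k) := by
    cases k with
    | zero => simp [hx0, hy0]
    | succ k => exact (hseq (2 * k) (even_two_mul k)).2.2.2
  have hstep (p) (hp : ∀ w, f p + g p ≤ f w + g w) (k : ℕ) :
      ‖y (2 * k + 2) - p‖ ^ 2 ≤ ‖y (2 * k) - p‖ ^ 2
        - (1 - γ * L / 2) * ‖x (2 * k + 1) - y (2 * k + 2)‖ ^ 2 := by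
    obtain ⟨hy1, hx1, hy2, -⟩ := hseq (2 * k) (even_two_mul k)
    have hfirst := norm_proxGrad_sub_sq_le hL hγ hf_conv hf_diff hf_lip hg_conv
      (hT (x (2 * k))) hp
    have hsecond := norm_proxGrad_sub_sq_le hL hγ hf_conv hf_diff hf_lip hg_conv
      (hT (x (2 * k + 1))) hp
    rw [← hy1, hxy] at hfirst
    rw [← hy2] at hsecond
    have hext := norm_extrapolate_sub_sq_le (hα (2 * k)).1
      ((hα (2 * k)).2.trans (min_one_div_sub_half_le (mul_pos hγ hL) hs2.le)) hfirst
    rw [← hx1] at hext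
    linarith
  have hfejer (p) (hp : ∀ w, f p + g p ≤ f w + g w) (k : ℕ) :
      ‖y (2 * k + 2) - p‖ ≤ ‖y (2 * k) - p‖ := by
    refine (sq_le_sq₀ (norm_nonneg _) (norm_nonneg _)).1 ?_
    linarith [hstep p hp k, mul_nonneg hc.le (sq_nonneg ‖x (2 * k + 1) - y (2 * k + 2)‖)]
  refine ⟨?_, hfejer⟩
  have hanti (p) (hp : ∀ w, f p + g p ≤ f w + g w) :
      Antitone fun k => dist (y (2 * k)) p :=
    antitone_nat_of_succ_le fun k => by simpa [dist_eq_norm, mul_add] using hfejer p hp k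
  obtain ⟨z, hz⟩ := hmin
  have hres : Tendsto (fun k => x (2 * k + 1) - y (2 * k + 2)) atTop (nhds 0) := by
    have hsq : Tendsto (fun k => (1 - γ * L / 2) * ‖x (2 * k + 1) - y (2 * k + 2)‖ ^ 2)
        atTop (nhds 0) :=
      tendsto_zero_of_le_sub_succ (a := fun k => ‖y (2 * k) - z‖ ^ 2) (fun k => sq_nonneg _)
        (fun k => by positivity) (fun k => by
          have := hstep z hz k
          simp only [mul_add, mul_one]
          linarith)
    have hnorm := ((hsq.const_mul (1 - γ * L / 2)⁻¹).sqrt)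
    simp only [inv_mul_cancel_left₀ hc.ne', mul_zero, Real.sqrt_zero,
      Real.sqrt_sq (norm_nonneg _)] at hnorm
    exact tendsto_zero_iff_norm_tendsto_zero.2 hnorm
  have hball (k : ℕ) : y (2 * (k + 1)) ∈ Metric.closedBall z (dist (y (2 * 0)) z) :=
    Metric.mem_closedBall.2 (hanti z hz (Nat.zero_le (k + 1)))
  obtain ⟨p, -, φ, hφ, hyφ⟩ := tendsto_subseq_of_bounded Metric.isBounded_closedBall hball
  have hf'_cont : Continuous f' :=
    (LipschitzWith.of_dist_le_mul (K := L.toNNReal) fun a b => by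
      simpa [dist_eq_norm, hL.le] using hf_lip a b).continuous
  have hxφ : Tendsto (fun k => x (2 * φ k + 1)) atTop (nhds p) := by
    simpa [Function.comp_def, mul_add] using (hres.comp hφ.tendsto_atTop).add hyφ
  have hp : ∀ w, f p + g p ≤ f w + g w :=
    forall_add_le_of_tendsto_proxGrad hγ hf_conv hf_diff hf'_cont hg_conv
      hg_conv.locallyLipschitz.continuous (fun k => by
        have hy2 := (hseq (2 * φ k) (even_two_mul _)).2.2.1
        simpa only [Function.comp_apply, mul_add, mul_one, hy2] using hT (x (2 * φ k + 1))) hxφ hyφ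
  exact ⟨p, hp, tendsto_of_antitone_dist_of_subseq (hanti p hp) (φ := fun k => φ k + 1) hyφ⟩
end

section
/- Suppose F satisfies the KL property with exponent θ ∈ [1/2, 1) and constant C > 0, and that (x_k) and (a_k) satisfy the weak descent property for F with a_k ≥ a > 0 for all k. Then there exists M ≥ 0 such that for all k: F(x_k) − F⋆ ≤ M·(C²/(C² + a))^k (linear convergence). -/
open scoped RealInnerProductSpace
open Filter

/-- A sequence that drops by at least `b > 0` at each step ending above `c` eventually reaches `c`. -/
theorem exists_le_of_forall_add_le {r : ℕ → ℝ} {b c : ℝ} (hb : 0 < b)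
    (hr : ∀ k, c < r (k + 1) → r (k + 1) + b ≤ r k) : ∃ K, r K ≤ c := by
  by_contra! h
  have hsum : ∀ k : ℕ, r k + k * b ≤ r 0 := by
    intro k
    induction k with
    | zero => simp
    | succ k ih =>
      have := hr k (h (k + 1))
      push_cast
      linarith
  obtain ⟨N, hN⟩ := exists_nat_gt ((r 0 - c) / b)
  rw [div_lt_iff₀ hb] at hN
  linarith [hsum N, h N]

/-- A nonnegative antitone sequence that contracts by `q` from some index on is `O(q ^ k)`. -/
theorem exists_le_mul_pow_of_eventually_contracting {r : ℕ → ℝ} {q : ℝ} {K : ℕ}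
    (hr0 : ∀ k, 0 ≤ r k) (hr : Antitone r) (hq0 : 0 < q) (hq1 : q ≤ 1)
    (hcontr : ∀ k, K ≤ k → r (k + 1) ≤ q * r k) :
    ∃ M, 0 ≤ M ∧ ∀ k, r k ≤ M * q ^ k := by
  have hM : 0 ≤ r 0 / q ^ K := div_nonneg (hr0 0) (by positivity)
  refine ⟨r 0 / q ^ K, hM, fun k => ?_⟩
  have hle : ∀ k, k ≤ K → r k ≤ r 0 / q ^ K * q ^ k := fun k hk => calc
    r k ≤ r 0 := hr (Nat.zero_le k)
    _ = r 0 / q ^ K * q ^ K := by field_simp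
    _ ≤ r 0 / q ^ K * q ^ k :=
      mul_le_mul_of_nonneg_left (pow_le_pow_of_le_one hq0.le hq1 hk) hM
  rcases le_total k K with hk | hk
  · exact hle k hk
  · induction k, hk using Nat.le_induction with
    | base => exact hle K le_rfl
    | succ k hk ih =>
      calc r (k + 1) ≤ q * r k := hcontr k hk
        _ ≤ q * (r 0 / q ^ K * q ^ k) := mul_le_mul_of_nonneg_left ih hq0.le
        _ = r 0 / q ^ K * q ^ (k + 1) := by ring

/-- A nonnegative sequence with `r (k + 1) + b * r (k + 1) ^ p ≤ r k`, where `0 ≤ p ≤ 1`,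
converges linearly with rate `1 / (1 + b)`. -/
theorem exists_le_mul_pow_of_add_mul_rpow_le {r : ℕ → ℝ} {b p : ℝ} (hb : 0 < b)
    (hp0 : 0 ≤ p) (hp1 : p ≤ 1) (hr0 : ∀ k, 0 ≤ r k) (hr : Antitone r)
    (hrec : ∀ k, 0 < r (k + 1) → r (k + 1) + b * r (k + 1) ^ p ≤ r k) :
    ∃ M, 0 ≤ M ∧ ∀ k, r k ≤ M * (1 / (1 + b)) ^ k := by
  obtain ⟨K, hK⟩ : ∃ K, r K ≤ 1 := by
    refine exists_le_of_forall_add_le hb fun k hk => ?_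
    have hpow : 1 ≤ r (k + 1) ^ p := Real.one_le_rpow hk.le hp0
    nlinarith [hrec k (by linarith)]
  refine exists_le_mul_pow_of_eventually_contracting (K := K) hr0 hr (by positivity)
    (by rw [div_le_one (by positivity)]; linarith) fun k hk => ?_
  rw [one_div, inv_mul_eq_div, le_div_iff₀ (by positivity)]
  rcases (hr0 (k + 1)).eq_or_lt with h0 | hpos
  · rw [← h0, zero_mul]
    exact hr0 k
  · have hpow : r (k + 1) ≤ r (k + 1) ^ p := by
      simpa using Real.rpow_le_rpow_of_exponent_ge hpos ((hr (hk.trans k.le_succ)).trans hK) hp1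
    nlinarith [hrec k hpos]

theorem stmt_10
    (n : ℕ) (hn : 0 < n)
    (F : EuclideanSpace ℝ (Fin n) → ℝ)
    (hF_conv : ConvexOn ℝ Set.univ F)
    (Fstar : ℝ) (hFstar_le : ∀ w, Fstar ≤ F w) (hFstar_att : ∃ z, F z = Fstar)
    (θ C : ℝ) (hθ : θ ∈ Set.Ico (1 / 2 : ℝ) 1) (hC : 0 < C)
    (hKL : ∀ x, F x > Fstar → ∀ v, (∀ w, F w ≥ F x + ⟪v, w - x⟫) →
        ‖v‖ ≥ (1 / C) * (F x - Fstar) ^ (1 - θ))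
    (x : ℕ → EuclideanSpace ℝ (Fin n)) (a : ℕ → ℝ) (ha : ∀ k, 0 ≤ a k)
    (hdesc : ∀ k, ∃ v, (∀ w, F w ≥ F (x (k + 1)) + ⟪v, w - x (k + 1)⟫)
        ∧ F (x (k + 1)) ≤ F (x k) - a k * ‖v‖ ^ 2)
    (aLB : ℝ) (haLB : 0 < aLB) (haLB' : ∀ k, aLB ≤ a k) :
    ∃ M, 0 ≤ M ∧ ∀ k,
      F (x k) - Fstar ≤ M * (C ^ 2 / (C ^ 2 + aLB)) ^ k := by
  have hrate : C ^ 2 / (C ^ 2 + aLB) = 1 / (1 + aLB / C ^ 2) := by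
    field_simp
  rw [hrate]
  refine exists_le_mul_pow_of_add_mul_rpow_le (r := fun k => F (x k) - Fstar)
    (p := (1 - θ) * 2) (by positivity) (by linarith [hθ.2]) (by linarith [hθ.1])
    (fun k => sub_nonneg.2 (hFstar_le _)) (antitone_nat_of_succ_le fun k => ?_) fun k hk => ?_
  · obtain ⟨v, -, hv⟩ := hdesc k
    have := mul_nonneg (ha k) (sq_nonneg ‖v‖)
    linarith
  · obtain ⟨v, hsub, hv⟩ := hdesc k
    have hnorm := hKL _ (sub_pos.1 hk) v hsub
    have hsq : ((1 / C) * (F (x (k + 1)) - Fstar) ^ (1 - θ)) ^ 2 ≤ ‖v‖ ^ 2 :=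
      pow_le_pow_left₀ (mul_nonneg (by positivity) (Real.rpow_nonneg hk.le _)) hnorm 2
    have hbound : aLB / C ^ 2 * (F (x (k + 1)) - Fstar) ^ ((1 - θ) * 2) ≤ a k * ‖v‖ ^ 2 := calc
      _ = aLB * ((1 / C) * (F (x (k + 1)) - Fstar) ^ (1 - θ)) ^ 2 := by
        rw [Real.rpow_mul hk.le, Real.rpow_two]
        ring
      _ ≤ a k * ‖v‖ ^ 2 := mul_le_mul (haLB' k) hsq (sq_nonneg _) (ha k)
    linarith
end

section
/- Suppose F satisfies the KL property with exponent θ ∈ (0, 1/2) and constant C > 0, and that (x_k) and (a_k) satisfy the weak descent property for F with a_k ≥ a > 0 for all k. Then there exists M ≥ 0 such that for all k ≥ 1: F(x_k) − F⋆ ≤ M·k^{−1/(1−2θ)}. -/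
open scoped RealInnerProductSpace
open Filter

/-- The chord bound for the convex function `t ↦ (1 + t) ^ p` on `[0, 1]`. -/
lemma one_add_rpow_le_chord {p t : ℝ} (hp : 1 ≤ p) (ht0 : 0 ≤ t) (ht1 : t ≤ 1) :
    (1 + t) ^ p ≤ 1 + (2 ^ p - 1) * t := by
  have h := (convexOn_rpow hp).2 (x := 1) (y := 2) (by simp) (by simp)
    (sub_nonneg.2 ht1) ht0 (by ring)
  simp only [smul_eq_mul, Real.one_rpow] at h
  calc (1 + t) ^ p = ((1 - t) * 1 + t * 2) ^ p := by congr 1; ring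
    _ ≤ (1 - t) * 1 + t * 2 ^ p := h
    _ = 1 + (2 ^ p - 1) * t := by ring

/-- A nonnegative sequence with `r (k + 1) + c * r (k + 1) ^ (1 + 1 / p) ≤ r k` decays at least
as fast as `k ^ (-p)`. -/
lemma exists_le_mul_rpow_neg_of_add_mul_rpow_le {r : ℕ → ℝ} {c p : ℝ} (hc : 0 < c) (hp : 1 ≤ p)
    (hr : ∀ k, 0 ≤ r k) (hrec : ∀ k, r (k + 1) + c * r (k + 1) ^ (1 + 1 / p) ≤ r k) :
    ∃ M, 0 ≤ M ∧ ∀ k : ℕ, 1 ≤ k → r k ≤ M * (k : ℝ) ^ (-p) := by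
  have hp0 : 0 < p := by linarith
  have h2p : (0 : ℝ) < 2 ^ p := by positivity
  set D : ℝ := 2 * 2 ^ p / c with hD
  have hD0 : 0 < D := by positivity
  have hM0 : 0 ≤ max (r 1) (D ^ p) := le_max_of_le_left (hr 1)
  refine ⟨max (r 1) (D ^ p), hM0, fun k hk => ?_⟩
  have hMD : D ^ p ≤ max (r 1) (D ^ p) := le_max_right _ _
  induction k, hk using Nat.le_induction with
  | base => simp
  | succ k hk ih =>
    generalize max (r 1) (D ^ p) = M at *
    by_contra! hlt
    have hk1 : (1 : ℝ) ≤ k := by exact_mod_cast hk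
    have hk0 : (0 : ℝ) < k := by linarith
    push_cast at hlt
    set A : ℝ := ((k : ℝ) + 1) ^ (-p) with hA
    have hA0 : 0 < A := by positivity
    have hpos : 0 < r (k + 1) := lt_of_le_of_lt (by positivity) hlt
    have hroot : D / (k + 1) ≤ r (k + 1) ^ (1 / p) := by
      rw [one_div, Real.le_rpow_inv_iff_of_pos (by positivity) hpos.le hp0,
        Real.div_rpow hD0.le (by positivity), div_eq_mul_inv, ← Real.rpow_neg (by positivity)]
      exact (mul_le_mul_of_nonneg_right hMD hA0.le).trans hlt.le
    have hratio : (k : ℝ) ^ (-p) = A * (1 + 1 / k) ^ p := by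
      rw [show (1 + 1 / (k : ℝ)) = (k + 1) / k by field_simp,
        Real.div_rpow (by positivity) hk0.le, hA, Real.rpow_neg (by positivity),
        Real.rpow_neg (by positivity)]
      field_simp
    have hchord : (1 + 1 / (k : ℝ)) ^ p ≤ 1 + c * (D / (k + 1)) := by
      refine (one_add_rpow_le_chord hp (by positivity) ((div_le_one hk0).2 hk1)).trans ?_
      have hinv : 1 / (k : ℝ) ≤ 2 / (k + 1) := by
        rw [div_le_div_iff₀ hk0 (by positivity)]; linarith
      have hcD : c * (D / (k + 1)) = 2 ^ p * (2 / (k + 1)) := by rw [hD]; field_simp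
      rw [hcD]
      have hk' : 0 ≤ 1 / (k : ℝ) := by positivity
      linarith [mul_le_mul_of_nonneg_left hinv h2p.le]
    have hstep := hrec k
    rw [Real.rpow_add hpos, Real.rpow_one] at hstep
    have hfactor : 0 < 1 + c * (D / (k + 1)) := by positivity
    have hchain : r (k + 1) * (1 + c * (D / (k + 1))) ≤ M * A * (1 + c * (D / (k + 1))) := by
      calc r (k + 1) * (1 + c * (D / (k + 1)))
          ≤ r (k + 1) * (1 + c * r (k + 1) ^ (1 / p)) := by gcongr
        _ ≤ r k := by linarith
        _ ≤ M * A * (1 + 1 / k) ^ p := by rw [mul_assoc, ← hratio]; exact ih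
        _ ≤ M * A * (1 + c * (D / (k + 1))) := by gcongr
    exact absurd (le_of_mul_le_mul_right hchain hfactor) (not_le.2 hlt)

theorem stmt_11
    (n : ℕ) (hn : 0 < n)
    (F : EuclideanSpace ℝ (Fin n) → ℝ)
    (hF_conv : ConvexOn ℝ Set.univ F)
    (Fstar : ℝ) (hFstar_le : ∀ w, Fstar ≤ F w) (hFstar_att : ∃ z, F z = Fstar)
    (θ C : ℝ) (hθ : θ ∈ Set.Ioo (0 : ℝ) (1 / 2)) (hC : 0 < C)
    (hKL : ∀ x, F x > Fstar → ∀ v, (∀ w, F w ≥ F x + ⟪v, w - x⟫) →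
        ‖v‖ ≥ (1 / C) * (F x - Fstar) ^ (1 - θ))
    (x : ℕ → EuclideanSpace ℝ (Fin n)) (a : ℕ → ℝ) (ha : ∀ k, 0 ≤ a k)
    (hdesc : ∀ k, ∃ v, (∀ w, F w ≥ F (x (k + 1)) + ⟪v, w - x (k + 1)⟫)
        ∧ F (x (k + 1)) ≤ F (x k) - a k * ‖v‖ ^ 2)
    (aLB : ℝ) (haLB : 0 < aLB) (haLB' : ∀ k, aLB ≤ a k) :
    ∃ M, 0 ≤ M ∧ ∀ k : ℕ, 1 ≤ k →
      F (x k) - Fstar ≤ M * (k : ℝ) ^ (-(1 / (1 - 2 * θ))) := by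
  obtain ⟨hθ0, hθ1⟩ := hθ
  have hden : 0 < 1 - 2 * θ := by linarith
  refine exists_le_mul_rpow_neg_of_add_mul_rpow_le (r := fun k => F (x k) - Fstar)
    (c := aLB * (1 / C) ^ 2) (by positivity) ((one_le_div hden).2 (by linarith))
    (fun k => sub_nonneg.2 (hFstar_le _)) fun k => ?_
  obtain ⟨v, hv, hdec⟩ := hdesc k
  have hexp : 1 + 1 / (1 / (1 - 2 * θ)) = (1 - θ) * (2 : ℕ) := by
    rw [one_div_one_div]; push_cast; ring
  have hnn : 0 ≤ F (x (k + 1)) - Fstar := sub_nonneg.2 (hFstar_le _)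
  rw [hexp, Real.rpow_mul hnn, Real.rpow_natCast]
  have hnorm : (1 / C) * (F (x (k + 1)) - Fstar) ^ (1 - θ) ≤ ‖v‖ := by
    rcases hnn.eq_or_lt with h0 | hpos
    · rw [← h0, Real.zero_rpow (by linarith), mul_zero]
      exact norm_nonneg v
    · exact hKL _ (sub_pos.1 hpos) v hv
  have hsq : aLB * ((1 / C) * (F (x (k + 1)) - Fstar) ^ (1 - θ)) ^ 2 ≤ a k * ‖v‖ ^ 2 :=
    mul_le_mul (haLB' k) (pow_le_pow_left₀ (by positivity) hnorm 2) (by positivity) (ha k)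
  rw [mul_pow, ← mul_assoc] at hsq
  linarith
end

section
/- Let d ∈ (0, 1). Suppose F satisfies the KL property with exponent θ ∈ [1/2, 1) and constant C > 0, and that (x_k) and (a_k) satisfy the weak descent property for F with a_k ≥ a/(k+1)^d for all k, for some a > 0. Then there exist ν > 0 and M ≥ 0 such that for all k ≥ 1: F(x_k) − F⋆ ≤ M·exp(−ν·k^{1−d}). -/
open scoped RealInnerProductSpace
open Filter

/-- One unit step of `t ↦ t ^ (1 - d)` is at most the derivative-like weight `1 / (k + 1) ^ d`. -/
theorem natCast_succ_rpow_one_sub_le {d : ℝ} (hd0 : 0 < d) (k : ℕ) :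
    ((k : ℝ) + 1) ^ (1 - d) ≤ (k : ℝ) ^ (1 - d) + 1 / ((k : ℝ) + 1) ^ d := by
  have hk1 : (0 : ℝ) < (k : ℝ) + 1 := by positivity
  have hsplit : ((k : ℝ) + 1) ^ (1 - d) = k / ((k : ℝ) + 1) ^ d + 1 / ((k : ℝ) + 1) ^ d := by
    rw [Real.rpow_sub hk1, Real.rpow_one, add_div]
  have hle : (k : ℝ) / ((k : ℝ) + 1) ^ d ≤ (k : ℝ) ^ (1 - d) := by
    rcases Nat.eq_zero_or_pos k with rfl | hk
    · simpa using Real.rpow_nonneg le_rfl _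
    · have hk0 : (0 : ℝ) < k := by exact_mod_cast hk
      rw [Real.rpow_sub hk0, Real.rpow_one]
      gcongr
      linarith
  linarith

/-- An exponential lower bound for `1 + c * s` on the unit interval. -/
theorem exp_div_one_add_mul_le {c s : ℝ} (hc : 0 < c) (hs0 : 0 ≤ s) (hs1 : s ≤ 1) :
    Real.exp (c / (1 + c) * s) ≤ 1 + c * s := by
  have hcs : 0 < 1 + c * s := by positivity
  rw [← Real.le_log_iff_exp_le hcs]
  refine le_trans ?_ (Real.one_sub_inv_le_log_of_pos hcs)
  have hinv : 1 - (1 + c * s)⁻¹ = c * s / (1 + c * s) := by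
    field_simp
    ring
  rw [hinv, div_mul_eq_mul_div]
  gcongr
  nlinarith

/-- A nonnegative sequence contracting by the factors `1 + c / (k + 1) ^ d` decays like
`exp (-ν * k ^ (1 - d))`. -/
theorem le_mul_exp_neg_rpow_of_contraction {r : ℕ → ℝ} {c d : ℝ} (hc : 0 < c)
    (hd : d ∈ Set.Ioo (0 : ℝ) 1) (hr : ∀ k, 0 ≤ r k)
    (hstep : ∀ k : ℕ, r (k + 1) * (1 + c * (1 / ((k : ℝ) + 1) ^ d)) ≤ r k) (k : ℕ) :
    r k ≤ r 0 * Real.exp (-(c / (1 + c)) * (k : ℝ) ^ (1 - d)) := by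
  induction k with
  | zero => simp [Real.zero_rpow (sub_pos.2 hd.2).ne']
  | succ k ih =>
    set s : ℝ := 1 / ((k : ℝ) + 1) ^ d with hs
    set ν : ℝ := c / (1 + c) with hν
    have hν0 : 0 < ν := by positivity
    have hs0 : 0 ≤ s := by positivity
    have hs1 : s ≤ 1 := by
      rw [hs, div_le_one (by positivity)]
      exact Real.one_le_rpow (by linarith [k.cast_nonneg (α := ℝ)]) hd.1.le
    have hmul : r (k + 1) * Real.exp (ν * s) ≤ r 0 * Real.exp (-ν * (k : ℝ) ^ (1 - d)) :=
      (mul_le_mul_of_nonneg_left (exp_div_one_add_mul_le hc hs0 hs1) (hr _)).trans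
        ((hstep k).trans ih)
    calc r (k + 1) = r (k + 1) * Real.exp (ν * s) * Real.exp (-(ν * s)) := by
          rw [mul_assoc, ← Real.exp_add, add_neg_cancel, Real.exp_zero, mul_one]
      _ ≤ r 0 * Real.exp (-ν * (k : ℝ) ^ (1 - d)) * Real.exp (-(ν * s)) := by gcongr
      _ = r 0 * Real.exp (-ν * ((k : ℝ) ^ (1 - d) + s)) := by
          rw [mul_assoc, ← Real.exp_add]
          congr 2
          ring
      _ ≤ r 0 * Real.exp (-ν * ((k + 1 : ℕ) : ℝ) ^ (1 - d)) := by
          refine mul_le_mul_of_nonneg_left (Real.exp_le_exp.2 ?_) (hr 0)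
          push_cast
          exact mul_le_mul_of_nonpos_left (natCast_succ_rpow_one_sub_le hd.1 k) (by linarith)

theorem stmt_12
    (n : ℕ) (hn : 0 < n)
    (F : EuclideanSpace ℝ (Fin n) → ℝ)
    (hF_conv : ConvexOn ℝ Set.univ F)
    (Fstar : ℝ) (hFstar_le : ∀ w, Fstar ≤ F w) (hFstar_att : ∃ z, F z = Fstar)
    (θ C : ℝ) (hθ : θ ∈ Set.Ico (1 / 2 : ℝ) 1) (hC : 0 < C)
    (hKL : ∀ x, F x > Fstar → ∀ v, (∀ w, F w ≥ F x + ⟪v, w - x⟫) →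
        ‖v‖ ≥ (1 / C) * (F x - Fstar) ^ (1 - θ))
    (x : ℕ → EuclideanSpace ℝ (Fin n)) (a : ℕ → ℝ) (ha : ∀ k, 0 ≤ a k)
    (hdesc : ∀ k, ∃ v, (∀ w, F w ≥ F (x (k + 1)) + ⟪v, w - x (k + 1)⟫)
        ∧ F (x (k + 1)) ≤ F (x k) - a k * ‖v‖ ^ 2)
    (d : ℝ) (hd : d ∈ Set.Ioo (0 : ℝ) 1)
    (aLB : ℝ) (haLB : 0 < aLB)
    (haLB' : ∀ k : ℕ, aLB / ((k : ℝ) + 1) ^ d ≤ a k) :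
    ∃ ν > (0 : ℝ), ∃ M, 0 ≤ M ∧ ∀ k : ℕ, 1 ≤ k →
      F (x k) - Fstar ≤ M * Real.exp (-ν * (k : ℝ) ^ (1 - d)) := by
  have hr : ∀ k, 0 ≤ F (x k) - Fstar := fun k => sub_nonneg.2 (hFstar_le _)
  have hanti : Antitone fun k => F (x k) := by
    refine antitone_nat_of_succ_le fun k => ?_
    obtain ⟨v, -, hv⟩ := hdesc k
    have := mul_nonneg (ha k) (sq_nonneg ‖v‖)
    linarith
  -- The shift by one keeps the base positive when `x 0` is already a minimizer.
  set R : ℝ := F (x 0) - Fstar + 1 with hR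
  have hR0 : 0 < R := by linarith [hr 0]
  set c : ℝ := aLB * (R ^ (1 - 2 * θ) / C ^ 2) with hc
  have hc0 : 0 < c := by positivity
  refine ⟨c / (1 + c), by positivity, F (x 0) - Fstar, hr 0, fun k _ =>
    le_mul_exp_neg_rpow_of_contraction (r := fun k => F (x k) - Fstar) hc0 hd hr
      (fun k => ?_) k⟩
  rcases (hr (k + 1)).eq_or_lt with h0 | hpos
  · simpa [← h0] using hFstar_le (x k)
  obtain ⟨v, hv, hle⟩ := hdesc k
  have hnorm := hKL _ (sub_pos.1 hpos) v hv
  set ρ : ℝ := F (x (k + 1)) - Fstar with hρ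
  have hρR : ρ ≤ R := by linarith [hanti (Nat.zero_le (k + 1))]
  have hsq : ρ * (R ^ (1 - 2 * θ) / C ^ 2) ≤ ‖v‖ ^ 2 := by
    calc ρ * (R ^ (1 - 2 * θ) / C ^ 2) ≤ ρ * (ρ ^ (1 - 2 * θ) / C ^ 2) := by
          have := Real.rpow_le_rpow_of_nonpos hpos hρR
            (show 1 - 2 * θ ≤ 0 by linarith [hθ.1])
          gcongr
      _ = ((1 / C) * ρ ^ (1 - θ)) ^ 2 := by
          have : (ρ ^ (1 - θ)) ^ 2 = ρ * ρ ^ (1 - 2 * θ) := by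
            rw [sq, ← Real.rpow_add hpos, ← Real.rpow_one_add' hpos.le (by linarith [hθ.2])]
            congr 1
            ring
          rw [mul_pow, this]
          ring
      _ ≤ ‖v‖ ^ 2 := by gcongr
  have hprod : aLB / ((k : ℝ) + 1) ^ d * (ρ * (R ^ (1 - 2 * θ) / C ^ 2)) ≤ a k * ‖v‖ ^ 2 :=
    mul_le_mul (haLB' k) hsq (by positivity) (ha k)
  calc ρ * (1 + c * (1 / ((k : ℝ) + 1) ^ d))
      = ρ + aLB / ((k : ℝ) + 1) ^ d * (ρ * (R ^ (1 - 2 * θ) / C ^ 2)) := by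
        rw [hc]
        ring
    _ ≤ F (x k) - Fstar := by linarith
end

section
/- Let d ∈ (0, 1). Suppose F satisfies the KL property with exponent θ ∈ (0, 1/2) and constant C > 0, and that (x_k) and (a_k) satisfy the weak descent property for F with a_k ≥ a/(k+1)^d for all k, for some a > 0. Then there exists M ≥ 0 such that for all k ≥ 1: F(x_k) − F⋆ ≤ M·k^{−(1−d)/(1−2θ)}. -/
open scoped RealInnerProductSpace
open Filter

/-- A form of `(1 + 1 / k) ^ q = 1 + O(1 / k)` with an explicit constant. -/
theorem rpow_succ_le_rpow_mul {q k : ℝ} (hq : 0 ≤ q) (hk : 1 ≤ k) :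
    (k + 1) ^ q ≤ k ^ q * (1 + 2 * q * Real.exp q / (k + 1)) := by
  have hk0 : 0 < k := by linarith
  have hsplit : (k + 1) ^ q = k ^ q * (1 + 1 / k) ^ q := by
    rw [← Real.mul_rpow hk0.le (by positivity)]
    congr 1
    field_simp
  rw [hsplit]
  gcongr
  have hqk : q / k ≤ q := div_le_self hq hk
  have hexp : (1 + 1 / k) ^ q ≤ Real.exp (q / k) := by
    have h := Real.rpow_le_rpow (by positivity) (Real.add_one_le_exp (1 / k)) hq
    rw [← Real.exp_mul, add_comm] at h
    convert h using 2
    ring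
  have hlin : Real.exp (q / k) ≤ 1 + q / k * Real.exp (q / k) := by
    have h := Real.add_one_le_exp (-(q / k))
    have hinv : Real.exp (-(q / k)) * Real.exp (q / k) = 1 := by
      rw [← Real.exp_add]
      simp
    nlinarith [Real.exp_pos (q / k)]
  have hmono : q / k * Real.exp (q / k) ≤ q / k * Real.exp q := by gcongr
  have hdiv : q / k * Real.exp q ≤ 2 * q * Real.exp q / (k + 1) := by
    rw [div_mul_eq_mul_div, div_le_div_iff₀ hk0 (by linarith)]
    nlinarith [mul_nonneg hq (Real.exp_pos q).le]
  linarith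

/-- A nonnegative sequence with `r (k + 1) + c / (k + 1) ^ d * r (k + 1) ^ (1 + p) ≤ r k`
decays at the rate `k ^ (-((1 - d) / p))`. -/
theorem exists_le_mul_rpow_of_descent {r : ℕ → ℝ} {c d p : ℝ} (hr : ∀ k, 0 ≤ r k)
    (hc : 0 < c) (hd : d < 1) (hp : 0 < p)
    (hstep : ∀ k : ℕ, r (k + 1) + c / ((k : ℝ) + 1) ^ d * r (k + 1) ^ (1 + p) ≤ r k) :
    ∃ M, 0 ≤ M ∧ ∀ k : ℕ, 1 ≤ k → r k ≤ M * (k : ℝ) ^ (-((1 - d) / p)) := by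
  set q := (1 - d) / p with hq_def
  have hq : 0 < q := div_pos (by linarith) hp
  set K := 2 * q * Real.exp q with hK_def
  have hK : 0 < K := by positivity
  set M := max (r 1) ((K / c) ^ (1 / p)) with hM_def
  have hM : 0 ≤ M := (hr 1).trans (le_max_left _ _)
  have hMp : K ≤ c * M ^ p := by
    have h : ((K / c) ^ (1 / p)) ^ p ≤ M ^ p :=
      Real.rpow_le_rpow (by positivity) (le_max_right _ _) hp.le
    rw [← Real.rpow_mul (by positivity), one_div_mul_cancel hp.ne', Real.rpow_one,
      div_le_iff₀ hc] at h
    linarith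
  refine ⟨M, hM, fun k hk => ?_⟩
  induction k, hk using Nat.le_induction with
  | base => simp [hM_def]
  | succ k hk ih =>
    have hk1 : (1 : ℝ) ≤ k := by exact_mod_cast hk
    have hk0 : (0 : ℝ) < k := by linarith
    push_cast
    set s := (k : ℝ) + 1 with hs_def
    have hs : 0 < s := by positivity
    by_contra! hlt
    have hB : 0 ≤ M * s ^ (-q) := by positivity
    have hR : 0 < r (k + 1) := hB.trans_lt hlt
    have hpow : M ^ p * s ^ (d - 1) ≤ r (k + 1) ^ p := by
      have h := Real.rpow_le_rpow hB hlt.le hp.le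
      rw [Real.mul_rpow hM (by positivity), ← Real.rpow_mul hs.le] at h
      convert h using 3
      rw [hq_def]
      field_simp
      ring
    have hgain : K / s ≤ c / s ^ d * r (k + 1) ^ p :=
      calc K / s ≤ c * M ^ p / s := by gcongr
        _ = c / s ^ d * (M ^ p * s ^ (d - 1)) := by
          rw [Real.rpow_sub_one hs.ne']
          field_simp
        _ ≤ c / s ^ d * r (k + 1) ^ p := by gcongr
    have hdesc : r (k + 1) * (1 + K / s) ≤ r k := by
      have h := hstep k
      rw [Real.rpow_add hR, Real.rpow_one] at h
      have h' := mul_le_mul_of_nonneg_left hgain hR.le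
      linarith
    have hcmp : (k : ℝ) ^ (-q) ≤ s ^ (-q) * (1 + K / s) := by
      have h := rpow_succ_le_rpow_mul hq.le hk1
      rw [Real.rpow_neg hk0.le, Real.rpow_neg hs.le, inv_mul_eq_div,
        le_div_iff₀ (by positivity), inv_mul_le_iff₀ (by positivity)]
      exact h
    have hlt' : M * s ^ (-q) * (1 + K / s) < r (k + 1) * (1 + K / s) := by gcongr
    have hle := mul_le_mul_of_nonneg_left hcmp hM
    linarith

theorem stmt_13
    (n : ℕ) (hn : 0 < n)
    (F : EuclideanSpace ℝ (Fin n) → ℝ)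
    (hF_conv : ConvexOn ℝ Set.univ F)
    (Fstar : ℝ) (hFstar_le : ∀ w, Fstar ≤ F w) (hFstar_att : ∃ z, F z = Fstar)
    (θ C : ℝ) (hθ : θ ∈ Set.Ioo (0 : ℝ) (1 / 2)) (hC : 0 < C)
    (hKL : ∀ x, F x > Fstar → ∀ v, (∀ w, F w ≥ F x + ⟪v, w - x⟫) →
        ‖v‖ ≥ (1 / C) * (F x - Fstar) ^ (1 - θ))
    (x : ℕ → EuclideanSpace ℝ (Fin n)) (a : ℕ → ℝ) (ha : ∀ k, 0 ≤ a k)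
    (hdesc : ∀ k, ∃ v, (∀ w, F w ≥ F (x (k + 1)) + ⟪v, w - x (k + 1)⟫)
        ∧ F (x (k + 1)) ≤ F (x k) - a k * ‖v‖ ^ 2)
    (d : ℝ) (hd : d ∈ Set.Ioo (0 : ℝ) 1)
    (aLB : ℝ) (haLB : 0 < aLB)
    (haLB' : ∀ k : ℕ, aLB / ((k : ℝ) + 1) ^ d ≤ a k) :
    ∃ M, 0 ≤ M ∧ ∀ k : ℕ, 1 ≤ k →
      F (x k) - Fstar ≤ M * (k : ℝ) ^ (-((1 - d) / (1 - 2 * θ))) := by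
  obtain ⟨hθ0, hθ1⟩ := hθ
  refine exists_le_mul_rpow_of_descent (r := fun k => F (x k) - Fstar) (c := aLB / C ^ 2)
    (fun k => sub_nonneg.2 (hFstar_le _)) (by positivity) hd.2 (by linarith) fun k => ?_
  obtain ⟨v, hv, hdec⟩ := hdesc k
  set R := F (x (k + 1)) - Fstar with hR_def
  have hR : 0 ≤ R := sub_nonneg.2 (hFstar_le _)
  have hgrad : 1 / C ^ 2 * R ^ (1 + (1 - 2 * θ)) ≤ ‖v‖ ^ 2 := by
    rcases hR.eq_or_lt with h0 | hpos
    · rw [← h0, Real.zero_rpow (by linarith), mul_zero]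
      positivity
    · have h := hKL _ (sub_pos.1 hpos) v hv
      have hsq := pow_le_pow_left₀ (by positivity) h 2
      rw [mul_pow, ← Real.rpow_mul_natCast hR, one_div_pow] at hsq
      have hexp : (1 - θ) * ((2 : ℕ) : ℝ) = 1 + (1 - 2 * θ) := by
        push_cast
        ring
      rwa [hexp] at hsq
  have hprod : aLB / ((k : ℝ) + 1) ^ d * (1 / C ^ 2 * R ^ (1 + (1 - 2 * θ))) ≤ a k * ‖v‖ ^ 2 :=
    mul_le_mul (haLB' k) hgrad (by positivity) (ha k)
  have hcomm : aLB / C ^ 2 / ((k : ℝ) + 1) ^ d * R ^ (1 + (1 - 2 * θ))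
      = aLB / ((k : ℝ) + 1) ^ d * (1 / C ^ 2 * R ^ (1 + (1 - 2 * θ))) := by
    ring
  linarith
end

section
/- Suppose F satisfies the KL property with exponent θ ∈ [1/2, 1) and constant C > 0, and that (x_k) and (a_k) satisfy the weak descent property for F with a_k ≥ a/(k+1) for all k, for some a > 0. Then there exists M ≥ 0 such that for all k ≥ 2: F(x_k) − F⋆ ≤ M·k^{−a/(2C²)}. -/
open scoped RealInnerProductSpace
open Filter

/-- A sequence decreasing by at least `c / (k + 1) * r (k + 1) ^ s` at each step
eventually drops below `1`, because the harmonic series diverges. -/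
lemma exists_le_one_of_rpow_descent {r : ℕ → ℝ} {c s : ℝ} (hc : 0 < c) (hs : 0 ≤ s)
    (hdec : ∀ k, 0 < r (k + 1) → r (k + 1) + c / ((k : ℝ) + 1) * r (k + 1) ^ s ≤ r k) :
    ∃ K, r K ≤ 1 := by
  by_contra! hbig
  have hsum : ∀ n, c * ∑ i ∈ Finset.range n, 1 / ((i : ℝ) + 1) ≤ r 0 - r n := by
    intro n
    induction n with
    | zero => simp
    | succ m ih =>
      have hstep := hdec m (by linarith [hbig (m + 1)])
      have hpow : 1 ≤ r (m + 1) ^ s := Real.one_le_rpow (hbig (m + 1)).le hs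
      have hmul : c / ((m : ℝ) + 1) * 1 ≤ c / ((m : ℝ) + 1) * r (m + 1) ^ s := by gcongr
      have hdiv : c * (1 / ((m : ℝ) + 1)) = c / ((m : ℝ) + 1) := by ring
      rw [Finset.sum_range_succ, mul_add, hdiv]
      linarith
  obtain ⟨m, hm⟩ :=
    (Real.tendsto_sum_range_one_div_nat_succ_atTop.eventually_ge_atTop (r 0 / c)).exists
  rw [div_le_iff₀ hc] at hm
  linarith [hsum m, hbig m]

/-- For large `t`, the factor `1 + c / t` dominates the growth of `t ^ (c / 2)` over one step. -/
lemma add_one_rpow_half_le {c t : ℝ} (hc : 0 < c) (ht : 0 < t) (hct : c ≤ 2 * t) :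
    (t + 1) ^ (c / 2) ≤ (1 + c / t) * t ^ (c / 2) := by
  have hfac : t + 1 = (1 + 1 / t) * t := by field_simp
  rw [hfac, Real.mul_rpow (by positivity) ht.le]
  gcongr
  have hx0 : 0 ≤ 1 / t * (c / 2) := by positivity
  have hx1 : 1 / t * (c / 2) ≤ 1 := by
    rw [div_mul_div_comm, div_le_one (by positivity)]
    linarith
  have hexp := (abs_le.mp (Real.abs_exp_sub_one_le (by rwa [abs_of_nonneg hx0]))).2
  rw [abs_of_nonneg hx0] at hexp
  calc (1 + 1 / t) ^ (c / 2) ≤ Real.exp (1 / t) ^ (c / 2) := by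
        gcongr
        linarith [Real.add_one_le_exp (1 / t)]
    _ = Real.exp (1 / t * (c / 2)) := (Real.exp_mul _ _).symm
    _ ≤ 1 + 2 * (1 / t * (c / 2)) := by linarith
    _ = 1 + c / t := by ring

/-- A nonnegative antitone sequence with `r (k + 1) + c / (k + 1) * r (k + 1) ^ s ≤ r k`,
`s ∈ [0, 1]`, decays at least like `k ^ (-c / 2)`. -/
lemma exists_le_mul_rpow_of_rpow_descent {r : ℕ → ℝ} {c s : ℝ} (hc : 0 < c) (hs : 0 ≤ s)
    (hs1 : s ≤ 1) (hr : ∀ k, 0 ≤ r k) (hanti : Antitone r)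
    (hdec : ∀ k, 0 < r (k + 1) → r (k + 1) + c / ((k : ℝ) + 1) * r (k + 1) ^ s ≤ r k) :
    ∃ M, 0 ≤ M ∧ ∀ k : ℕ, 0 < k → r k ≤ M * (k : ℝ) ^ (-(c / 2)) := by
  obtain ⟨K₀, hK₀⟩ := exists_le_one_of_rpow_descent hc hs hdec
  obtain ⟨K₁, hK₁⟩ := exists_nat_ge c
  set K := max K₀ K₁
  have hbound : ∀ k : ℕ, r k * ((k : ℝ) + 1) ^ (c / 2) ≤ r 0 * ((K : ℝ) + 1) ^ (c / 2) := by
    intro k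
    rcases le_total k K with hk | hk
    · have := hr 0
      have := hanti (Nat.zero_le k)
      gcongr
    · induction k, hk using Nat.le_induction with
      | base =>
        gcongr
        exact hanti (Nat.zero_le K)
      | succ m hm ih =>
        refine le_trans ?_ ih
        have hcm : c ≤ 2 * ((m : ℝ) + 1) := by
          have : (K₁ : ℝ) ≤ m := by exact_mod_cast (le_max_right K₀ K₁).trans hm
          linarith [Nat.cast_nonneg (α := ℝ) m]
        have hgrow := add_one_rpow_half_le hc (by positivity : (0 : ℝ) < m + 1) hcm
        have hstep : r (m + 1) * (1 + c / ((m : ℝ) + 1)) ≤ r m := by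
          rcases (hr (m + 1)).eq_or_lt with h0 | hpos
          · rw [← h0, zero_mul]
            exact hr m
          · have hle : r (m + 1) ≤ 1 :=
              (hanti (((le_max_left K₀ K₁).trans hm).trans (Nat.le_succ m))).trans hK₀
            have hpow : r (m + 1) ≤ r (m + 1) ^ s := by
              simpa using Real.rpow_le_rpow_of_exponent_ge hpos hle hs1
            have hmul : c / ((m : ℝ) + 1) * r (m + 1) ≤ c / ((m : ℝ) + 1) * r (m + 1) ^ s := by
              gcongr
            linarith [hdec m hpos]
        push_cast
        calc r (m + 1) * ((m : ℝ) + 1 + 1) ^ (c / 2)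
            ≤ r (m + 1) * ((1 + c / ((m : ℝ) + 1)) * ((m : ℝ) + 1) ^ (c / 2)) :=
              mul_le_mul_of_nonneg_left hgrow (hr _)
          _ = r (m + 1) * (1 + c / ((m : ℝ) + 1)) * ((m : ℝ) + 1) ^ (c / 2) := by ring
          _ ≤ r m * ((m : ℝ) + 1) ^ (c / 2) := by gcongr
  refine ⟨r 0 * ((K : ℝ) + 1) ^ (c / 2), mul_nonneg (hr 0) (by positivity), fun k hk => ?_⟩
  have hk' : (0 : ℝ) < k := by exact_mod_cast hk
  rw [Real.rpow_neg hk'.le, ← div_eq_mul_inv, le_div_iff₀ (by positivity)]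
  refine le_trans (mul_le_mul_of_nonneg_left ?_ (hr k)) (hbound k)
  gcongr
  linarith

theorem stmt_14
    (n : ℕ) (hn : 0 < n)
    (F : EuclideanSpace ℝ (Fin n) → ℝ)
    (hF_conv : ConvexOn ℝ Set.univ F)
    (Fstar : ℝ) (hFstar_le : ∀ w, Fstar ≤ F w) (hFstar_att : ∃ z, F z = Fstar)
    (θ C : ℝ) (hθ : θ ∈ Set.Ico (1 / 2 : ℝ) 1) (hC : 0 < C)
    (hKL : ∀ x, F x > Fstar → ∀ v, (∀ w, F w ≥ F x + ⟪v, w - x⟫) →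
        ‖v‖ ≥ (1 / C) * (F x - Fstar) ^ (1 - θ))
    (x : ℕ → EuclideanSpace ℝ (Fin n)) (a : ℕ → ℝ) (ha : ∀ k, 0 ≤ a k)
    (hdesc : ∀ k, ∃ v, (∀ w, F w ≥ F (x (k + 1)) + ⟪v, w - x (k + 1)⟫)
        ∧ F (x (k + 1)) ≤ F (x k) - a k * ‖v‖ ^ 2)
    (aLB : ℝ) (haLB : 0 < aLB)
    (haLB' : ∀ k : ℕ, aLB / ((k : ℝ) + 1) ≤ a k) :
    ∃ M, 0 ≤ M ∧ ∀ k : ℕ, 2 ≤ k →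
      F (x k) - Fstar ≤ M * (k : ℝ) ^ (-(aLB / (2 * C ^ 2))) := by
  have hr : ∀ k, 0 ≤ F (x k) - Fstar := fun k => sub_nonneg.mpr (hFstar_le _)
  have hanti : Antitone fun k => F (x k) - Fstar := by
    refine antitone_nat_of_succ_le fun k => ?_
    obtain ⟨v, -, hv⟩ := hdesc k
    have := mul_nonneg (ha k) (sq_nonneg ‖v‖)
    linarith
  have hdec : ∀ k, 0 < F (x (k + 1)) - Fstar →
      F (x (k + 1)) - Fstar
        + aLB / C ^ 2 / ((k : ℝ) + 1) * (F (x (k + 1)) - Fstar) ^ (2 * (1 - θ))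
        ≤ F (x k) - Fstar := by
    intro k hpos
    obtain ⟨v, hsub, hv⟩ := hdesc k
    have hnorm := hKL _ (sub_pos.mp hpos) v hsub
    have hsq : (1 / C * (F (x (k + 1)) - Fstar) ^ (1 - θ)) ^ 2 ≤ ‖v‖ ^ 2 :=
      pow_le_pow_left₀ (by positivity) hnorm 2
    have hpow : (F (x (k + 1)) - Fstar) ^ (2 * (1 - θ))
        = ((F (x (k + 1)) - Fstar) ^ (1 - θ)) ^ 2 := by
      rw [mul_comm, Real.rpow_mul hpos.le, Real.rpow_two]
    have hmul := mul_le_mul (haLB' k) hsq (sq_nonneg _) (ha k)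
    have heq : aLB / C ^ 2 / ((k : ℝ) + 1) * ((F (x (k + 1)) - Fstar) ^ (1 - θ)) ^ 2
        = aLB / ((k : ℝ) + 1) * (1 / C * (F (x (k + 1)) - Fstar) ^ (1 - θ)) ^ 2 := by
      ring
    rw [hpow, heq]
    linarith
  obtain ⟨M, hM, hbound⟩ := exists_le_mul_rpow_of_rpow_descent (by positivity)
    (by linarith [hθ.2]) (by linarith [hθ.1]) hr hanti hdec
  refine ⟨M, hM, fun k hk => ?_⟩
  have hexp : aLB / (2 * C ^ 2) = aLB / C ^ 2 / 2 := by ring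
  rw [hexp]
  exact hbound k (by lia)
end
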